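/- arXiv:2306.01674 — 4 statements merged into one kernel-verified Lean document; each statement's English description precedes it below -/
import Mathlib

section
/- Let d_h, D be positive integers and T > 0. Equip ℝ^{d_h} and ℝ^D with the Euclidean norm, and write [−1,1]^{d_h} (resp. [−1.1,1.1]^{d_h}, [−1,1]^D) for the set of vectors all of whose coordinates lie in the indicated interval. Let x : [0, T] → ℝ^D be continuous with x(t) ∈ [−1,1]^D for all t. Let f, f_θ : ℝ^{d_h} × ℝ^D → ℝ^{d_h} be continuous. Let h, h_NN : [0, T] → ℝ^{d_h} be differentiable with h(0) = h_NN(0), h'(t) = f(h(t), x(t)) and h(t) ∈ [−1,1]^{d_h} for all t ∈ [0, T], and h_NN'(t) = f_θ(h_NN(t), x(t)) for all t ∈ [0, T]. Let L : [0, T] → [0, ∞) be integrable and suppose that for every s ∈ [0, T] and all η₁, η₂ ∈ [−1.1,1.1]^{d_h}, ‖f(η₁, x(s)) − f(η₂, x(s))‖ ≤ L(s)·‖η₁ − η₂‖. Let ε_f > 0 satisfy ‖f(η, ξ) − f_θ(η, ξ)‖ ≤ ε_f for all η ∈ [−1.1,1.1]^{d_h} and ξ ∈ [−1,1]^D, together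 with the smallness condition T·ε_f·exp(∫_0^T L(s) ds) < 0.1. Then for every t ∈ [0, T], ‖h(t) − h_NN(t)‖ ≤ ε_f·T·exp(∫_0^T L(s) ds) < 0.1; in particular h_NN(t) ∈ [−1.1,1.1]^{d_h} for all t ∈ [0, T]. -/
open MeasureTheory intervalIntegral


lemma ac_exp_comp {g : ℝ → ℝ} {a b : ℝ} (hg : AbsolutelyContinuousOnInterval g a b) :
    AbsolutelyContinuousOnInterval (fun x => Real.exp (g x)) a b := by
  obtain ⟨C, hC⟩ := hg.exists_bound
  obtain ⟨K, hK⟩ := (Real.contDiff_exp (n := 1)).contDiffOn.exists_lipschitzOnWith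
    (s := Set.Icc (-C) C) (by decide) (convex_Icc _ _) isCompact_Icc
  unfold AbsolutelyContinuousOnInterval at hg ⊢
  apply squeeze_zero' ?_ ?_ (by simpa using hg.const_mul (K : ℝ))
  · exact Filter.Eventually.of_forall <| fun _ ↦ Finset.sum_nonneg (fun i hi ↦ dist_nonneg)
  rw [Filter.eventually_inf_principal]
  filter_upwards with E hE
  rw [Finset.mul_sum]
  refine Finset.sum_le_sum fun i hi => ?_
  have h1 := hE.1 i hi
  exact hK.dist_le_mul _ (abs_le.1 (hC _ h1.1)) _ (abs_le.1 (hC _ h1.2))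

lemma integral_mul_exp_integral {L : ℝ → ℝ} {t : ℝ}
    (hL : IntervalIntegrable L volume 0 t) :
    ∫ s in (0:ℝ)..t, L s * Real.exp (∫ r in (0:ℝ)..s, L r)
      = Real.exp (∫ r in (0:ℝ)..t, L r) - 1 := by
  have hac := ac_exp_comp (hL.absolutelyContinuousOnInterval_intervalIntegral
    (c := 0) (by simp))
  have := hac.integral_deriv_eq_sub
  simp only [integral_same, Real.exp_zero] at this
  rw [← this]
  apply intervalIntegral.integral_congr_ae
  filter_upwards [hL.ae_hasDerivAt_integral] with y hy hy2
  have := (hy (Set.uIoc_subset_uIcc hy2) 0 (by simp)).exp.deriv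
  rw [this, mul_comm]

/-- Continuous-time approximation of the hidden state of the RNN-ODE model: if `f_θ` is
uniformly `ε_f`-close to `f` on `[−1.1,1.1]^{d_h} × [−1,1]^D`, `L s` is a time-dependent
Lipschitz bound for `f` in its first argument, and `T·ε_f·exp(∫₀ᵀ L) < 0.1`, then the
neural hidden trajectory stays `ε_f·T·exp(∫₀ᵀ L) (< 0.1)`-close to the true one, and in
particular remains in `[−1.1,1.1]^{d_h}`. -/
theorem rnn_ode_hidden_state_approximation
    (dh D : ℕ) (hdh : 0 < dh) (hD : 0 < D) (T : ℝ) (hT : 0 < T)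
    (x : ℝ → EuclideanSpace ℝ (Fin D))
    (hx_cont : ContinuousOn x (Set.Icc 0 T))
    (hx_range : ∀ t ∈ Set.Icc 0 T, ∀ j, |x t j| ≤ 1)
    (f fθ : EuclideanSpace ℝ (Fin dh) → EuclideanSpace ℝ (Fin D) → EuclideanSpace ℝ (Fin dh))
    (hf_cont : Continuous fun p : EuclideanSpace ℝ (Fin dh) × EuclideanSpace ℝ (Fin D) => f p.1 p.2)
    (hfθ_cont : Continuous fun p : EuclideanSpace ℝ (Fin dh) × EuclideanSpace ℝ (Fin D) => fθ p.1 p.2)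
    (h hNN : ℝ → EuclideanSpace ℝ (Fin dh))
    (h0 : h 0 = hNN 0)
    (hh_deriv : ∀ t ∈ Set.Icc 0 T, HasDerivWithinAt h (f (h t) (x t)) (Set.Icc 0 T) t)
    (hh_range : ∀ t ∈ Set.Icc 0 T, ∀ i, |h t i| ≤ 1)
    (hNN_deriv : ∀ t ∈ Set.Icc 0 T, HasDerivWithinAt hNN (fθ (hNN t) (x t)) (Set.Icc 0 T) t)
    (L : ℝ → ℝ)
    (hL_nonneg : ∀ s ∈ Set.Icc 0 T, 0 ≤ L s)
    (hL_int : IntegrableOn L (Set.Icc 0 T))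
    (hLip : ∀ s ∈ Set.Icc 0 T, ∀ η₁ η₂ : EuclideanSpace ℝ (Fin dh),
      (∀ i, |η₁ i| ≤ 1.1) → (∀ i, |η₂ i| ≤ 1.1) →
      ‖f η₁ (x s) - f η₂ (x s)‖ ≤ L s * ‖η₁ - η₂‖)
    (εf : ℝ) (hεf_pos : 0 < εf)
    (hεf : ∀ η : EuclideanSpace ℝ (Fin dh), ∀ ξ : EuclideanSpace ℝ (Fin D),
      (∀ i, |η i| ≤ 1.1) → (∀ j, |ξ j| ≤ 1) → ‖f η ξ - fθ η ξ‖ ≤ εf)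
    (hsmall : T * εf * Real.exp (∫ s in (0 : ℝ)..T, L s) < 0.1) :
    (∀ t ∈ Set.Icc 0 T,
      ‖h t - hNN t‖ ≤ εf * T * Real.exp (∫ s in (0 : ℝ)..T, L s))
    ∧ εf * T * Real.exp (∫ s in (0 : ℝ)..T, L s) < 0.1
    ∧ (∀ t ∈ Set.Icc 0 T, ∀ i, |hNN t i| ≤ 1.1) := by
  set M := Real.exp (∫ s in (0 : ℝ)..T, L s) with hM
  have hMpos : 0 < M := Real.exp_pos _
  set Λ : ℝ → ℝ := fun t => ∫ s in (0 : ℝ)..t, L s with hΛ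
  have hLii : ∀ t ∈ Set.Icc 0 T, IntervalIntegrable L volume 0 t := fun t ht =>
    (intervalIntegrable_iff_integrableOn_Icc_of_le ht.1).2
      (hL_int.mono_set (Set.Icc_subset_Icc_right ht.2))
  have hΛc : ContinuousOn Λ (Set.Icc 0 T) := by
    have := ((hLii T ⟨hT.le, le_rfl⟩).absolutelyContinuousOnInterval_intervalIntegral
      (c := 0) (by simp)).continuousOn
    rwa [Set.uIcc_of_le hT.le] at this
  have hΛM : ∀ t ∈ Set.Icc 0 T, Real.exp (Λ t) ≤ M := by
    intro t ht
    refine Real.exp_le_exp.2 ?_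
    refine integral_mono_interval le_rfl ht.1 ht.2 ?_ (hLii T ⟨hT.le, le_rfl⟩)
    filter_upwards [ae_restrict_mem measurableSet_Ioc] with s hs
    exact hL_nonneg s ⟨hs.1.le, hs.2⟩
  have hhc : ContinuousOn h (Set.Icc 0 T) := fun t ht => (hh_deriv t ht).continuousWithinAt
  have hNc : ContinuousOn hNN (Set.Icc 0 T) := fun t ht => (hNN_deriv t ht).continuousWithinAt
  have hec : ContinuousOn (fun t => ‖h t - hNN t‖) (Set.Icc 0 T) := (hhc.sub hNc).norm
  -- vectors close to `h t` lie in the enlarged cube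
  have hbox : ∀ t ∈ Set.Icc 0 T, ‖h t - hNN t‖ ≤ 0.1 → ∀ i, |hNN t i| ≤ 1.1 := by
    intro t ht hle i
    have h1 := PiLp.norm_apply_le (h t - hNN t) i
    have h2 := hh_range t ht i
    simp only [PiLp.sub_apply, Real.norm_eq_abs] at h1
    rw [abs_le] at h2 ⊢
    have h3 := abs_le.1 (h1.trans hle)
    constructor <;> linarith [h3.1, h3.2, h2.1, h2.2]
  -- main bootstrap
  have key : ∀ C : ℝ, εf * T < C → C * M < 0.1 → ∀ t ∈ Set.Icc 0 T,
      ‖h t - hNN t‖ ≤ C * Real.exp (Λ t) := by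
    intro C hC hCM
    have hCpos : 0 < C := lt_trans (by positivity) hC
    have hFc : ContinuousOn (fun t => C * Real.exp (Λ t) - ‖h t - hNN t‖) (Set.Icc 0 T) :=
      (continuousOn_const.mul hΛc.rexp).sub hec
    have step : ∀ t ∈ Set.Icc 0 T,
        (∀ s ∈ Set.Icc 0 t, ‖h s - hNN s‖ ≤ C * Real.exp (Λ s)) →
        ‖h t - hNN t‖ < C * Real.exp (Λ t) := by
      intro t ht hs
      have hsub : Set.Icc 0 t ⊆ Set.Icc 0 T := Set.Icc_subset_Icc_right ht.2
      have hdc : ContinuousOn (fun s => f (h s) (x s) - fθ (hNN s) (x s)) (Set.Icc 0 t) :=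
        ((hf_cont.comp_continuousOn (hhc.prodMk hx_cont)).sub
          (hfθ_cont.comp_continuousOn (hNc.prodMk hx_cont))).mono hsub
      have hFTC : ∫ s in (0:ℝ)..t, (f (h s) (x s) - fθ (hNN s) (x s)) = h t - hNN t := by
        have := integral_eq_sub_of_hasDeriv_right_of_le (f := fun s => h s - hNN s) ht.1
          ((hhc.sub hNc).mono hsub)
          (f' := fun s => f (h s) (x s) - fθ (hNN s) (x s)) ?_ ?_
        · simpa [h0] using this
        · intro s hs
          have hsT : s ∈ Set.Icc 0 T := hsub ⟨hs.1.le, hs.2.le⟩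
          have hn : Set.Icc 0 T ∈ nhds s := Icc_mem_nhds hs.1 (hs.2.trans_le ht.2)
          exact (((hh_deriv s hsT).sub (hNN_deriv s hsT)).hasDerivAt hn).hasDerivWithinAt
        · exact (hdc.intervalIntegrable_of_Icc ht.1)
      have hexpc : ContinuousOn (fun s => Real.exp (Λ s)) (Set.Icc 0 t) := (hΛc.mono hsub).rexp
      have hLexp : IntervalIntegrable (fun s => L s * Real.exp (Λ s)) volume 0 t :=
        (hLii t ht).mul_continuousOn (by rwa [Set.uIcc_of_le ht.1])
      have hbd : ∀ s ∈ Set.Icc 0 t, ‖f (h s) (x s) - fθ (hNN s) (x s)‖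
          ≤ εf + C * (L s * Real.exp (Λ s)) := by
        intro s hst
        have hsT := hsub hst
        have h1 := hs s hst
        have h2 : ‖h s - hNN s‖ ≤ 0.1 :=
          h1.trans ((mul_le_mul_of_nonneg_left (hΛM s hsT) hCpos.le).trans hCM.le)
        have hb := hbox s hsT h2
        have h3 := hLip s hsT (h s) (hNN s)
          (fun i => (hh_range s hsT i).trans (by norm_num)) hb
        have h4 := hεf (hNN s) (x s) hb (hx_range s hsT)
        have h5 := mul_le_mul_of_nonneg_left h1 (hL_nonneg s hsT)
        have h6 := norm_sub_le_norm_sub_add_norm_sub (f (h s) (x s)) (f (hNN s) (x s))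
          (fθ (hNN s) (x s))
        linarith
      calc ‖h t - hNN t‖ = ‖∫ s in (0:ℝ)..t, (f (h s) (x s) - fθ (hNN s) (x s))‖ := by
            rw [hFTC]
        _ ≤ ∫ s in (0:ℝ)..t, ‖f (h s) (x s) - fθ (hNN s) (x s)‖ :=
            norm_integral_le_integral_norm ht.1
        _ ≤ ∫ s in (0:ℝ)..t, (εf + C * (L s * Real.exp (Λ s))) :=
            integral_mono_on ht.1 (hdc.norm.intervalIntegrable_of_Icc ht.1)
              (intervalIntegrable_const.add (hLexp.const_mul C)) hbd
        _ = t * εf + C * (Real.exp (Λ t) - 1) := by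
            rw [integral_add intervalIntegrable_const (hLexp.const_mul C),
              intervalIntegral.integral_const_mul, integral_mul_exp_integral (hLii t ht)]
            simp [hΛ]
        _ ≤ εf * T + C * (Real.exp (Λ t) - 1) := by
            have := mul_le_mul_of_nonneg_left ht.2 hεf_pos.le
            linarith
        _ < C * Real.exp (Λ t) := by linarith
    have hcl : IsClosed ({t | ‖h t - hNN t‖ ≤ C * Real.exp (Λ t)} ∩ Set.Icc 0 T) := by
      have := hFc.preimage_isClosed_of_isClosed isClosed_Icc (isClosed_Ici (a := (0:ℝ)))
      rw [Set.inter_comm] at this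
      convert this using 2
      ext t
      simp
    refine hcl.Icc_subset_of_forall_mem_nhdsGT_of_Icc_subset ?_ ?_
    · simp [h0, hΛ, hCpos.le]
    · intro t ht hsub
      have hlt := step t ⟨ht.1, ht.2.le⟩ (fun s hs => hsub hs)
      have h1 : ∀ᶠ s in nhdsWithin t (Set.Icc 0 T),
          0 < C * Real.exp (Λ s) - ‖h s - hNN s‖ :=
        (hFc t ⟨ht.1, ht.2.le⟩).eventually (lt_mem_nhds (sub_pos.2 hlt))
      have h2 : nhdsWithin t (Set.Ioi t) ≤ nhdsWithin t (Set.Icc 0 T) :=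
        nhdsWithin_le_of_mem (Filter.mem_of_superset (Ioc_mem_nhdsGT ht.2)
          (fun s hs => ⟨ht.1.trans hs.1.le, hs.2⟩))
      filter_upwards [h2 h1] with s hs
      exact (sub_pos.1 hs).le
  have hsm : εf * T * M < 0.1 := by rwa [mul_comm εf T]
  have main : ∀ t ∈ Set.Icc 0 T, ‖h t - hNN t‖ ≤ εf * T * M := by
    intro t ht
    refine le_of_forall_gt_imp_ge_of_dense fun y hy => ?_
    obtain ⟨z, hz1, hz2⟩ := exists_between (lt_min hy hsm)
    have hz3 := lt_min_iff.1 hz2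
    have := key (z / M) ((lt_div_iff₀ hMpos).2 hz1)
      (by rw [div_mul_cancel₀ _ hMpos.ne']; exact hz3.2) t ht
    have hzpos : 0 < z := lt_trans (by positivity) hz1
    calc _ ≤ _ := this
      _ ≤ z / M * M := mul_le_mul_of_nonneg_left (hΛM t ht) (by positivity)
      _ = z := div_mul_cancel₀ _ hMpos.ne'
      _ ≤ y := hz3.1.le
  exact ⟨main, hsm, fun t ht => hbox t ht ((main t ht).trans hsm.le)⟩
end

section
/- Let d_h, D, D' be positive integers and T > 0. Equip ℝ^{d_h}, ℝ^D and ℝ^{D'} with the Euclidean norm, and write [−1,1]^{d_h} (resp. [−1.1,1.1]^{d_h}, [−1,1]^D) for the set of vectors all of whose coordinates lie in the indicated interval. Let x : [0, T] → ℝ^D be continuous with x(t) ∈ [−1,1]^D for all t. Let f, f_θ : ℝ^{d_h} × ℝ^D → ℝ^{d_h} be continuous. Let h, h_NN : [0, T] → ℝ^{d_h} be differentiable with h(0) = h_NN(0), h'(t) = f(h(t), x(t)) and h(t) ∈ [−1,1]^{d_h} for all t ∈ [0, T], and h_NN'(t) = f_θ(h_NN(t), x(t)) for all t ∈ [0, T].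 Let L : [0, T] → [0, ∞) be integrable with ‖f(η₁, x(s)) − f(η₂, x(s))‖ ≤ L(s)·‖η₁ − η₂‖ for every s ∈ [0, T] and all η₁, η₂ ∈ [−1.1,1.1]^{d_h}. Let ε_f > 0 satisfy ‖f(η, ξ) − f_θ(η, ξ)‖ ≤ ε_f on [−1.1,1.1]^{d_h} × [−1,1]^D and T·ε_f·exp(∫_0^T L(s) ds) < 0.1. Furthermore, let g, g_φ : ℝ^{d_h} → ℝ^{D'}, let L_g ≥ 0 be such that ‖g(η₁) − g(η₂)‖ ≤ L_g·‖η₁ − η₂‖ for all η₁, η₂ ∈ [−1.1,1.1]^{d_h}, and let ε_g > 0 satisfy ‖g(η) − g_φ(η)‖ ≤ ε_g for all η ∈ [−1.1,1.1]^{d_h}. Define y(t) = g(h(t)) and y_NN(t) = g_φ(h_NN(t)). Then for every t ∈ [0, T], ‖y(t) − y_NN(t)‖ ≤ ε_g + L_g·T·exp(∫_0^T L(s) ds)·ε_f. -/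
open MeasureTheory intervalIntegral

lemma gron_aux {E : Type*} [NormedAddCommGroup E] [InnerProductSpace ℝ E]
    (e e' : ℝ → E) (L : ℝ → ℝ) (b ε : ℝ) (hb : 0 ≤ b) (hε : 0 < ε)
    (hc : ContinuousOn e (Set.Icc 0 b)) (he0 : e 0 = 0)
    (hd : ∀ t ∈ Set.Ioo 0 b, HasDerivAt e (e' t) t)
    (hbd : ∀ t ∈ Set.Ioo 0 b, ‖e' t‖ ≤ L t * ‖e t‖ + ε)
    (hL : ∀ t ∈ Set.Icc 0 b, 0 ≤ L t) (hLi : IntegrableOn L (Set.Icc 0 b)) :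
    ‖e b‖ ≤ ε * b * Real.exp (∫ s in (0 : ℝ)..b, L s) := by
  have hI : 0 ≤ ∫ s in (0 : ℝ)..b, L s := intervalIntegral.integral_nonneg hb hL
  have hE1 : 1 ≤ Real.exp (∫ s in (0 : ℝ)..b, L s) := Real.one_le_exp hI
  have key : ∀ δ > 0, ‖e b‖ ≤ (δ + ε * b) * Real.exp (∫ s in (0 : ℝ)..b, L s) := by
    intro δ hδ
    by_contra! hcon
    have hmb : 0 < δ + ε * b := by positivity
    have hgt : δ + ε * b < ‖e b‖ := by nlinarith
    have hq : ContinuousOn (fun s => ‖e s‖ - (δ + ε * s)) (Set.Icc 0 b) :=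
      hc.norm.sub (by fun_prop)
    have hScl : IsCompact (Set.Icc 0 b ∩ (fun s => ‖e s‖ - (δ + ε * s)) ⁻¹' Set.Iic 0) :=
      isCompact_Icc.of_isClosed_subset
        (hq.preimage_isClosed_of_isClosed isClosed_Icc isClosed_Iic) Set.inter_subset_left
    obtain ⟨a, ⟨ha, haS⟩, hag⟩ := hScl.exists_isGreatest
      ⟨0, ⟨le_rfl, hb⟩, by simp [he0]; exact hδ.le⟩
    simp only [Set.mem_preimage, Set.mem_Iic] at haS
    have hab : a < b := by
      rcases ha.2.lt_or_eq with h | h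
      · exact h
      · subst h; linarith
    have hsub : Set.Icc a b ⊆ Set.Icc 0 b := Set.Icc_subset_Icc_left ha.1
    have hgt' : ∀ s ∈ Set.Ioc a b, δ + ε * s < ‖e s‖ := by
      intro s hs
      by_contra! hle
      have := hag ⟨hsub ⟨hs.1.le, hs.2⟩, by simpa using hle⟩
      linarith [hs.1]
    have haeq : ‖e a‖ = δ + ε * a := by
      obtain ⟨c, hcI, hc0⟩ := intermediate_value_Icc hab.le (hq.mono hsub)
        (show (0:ℝ) ∈ Set.Icc _ _ from ⟨haS, by simpa using hgt.le⟩)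
      simp only at hc0
      rcases hcI.1.lt_or_eq with h | h
      · linarith [hgt' c ⟨h, hcI.2⟩]
      · subst h; linarith
    have hm : ∀ s ∈ Set.Icc a b, 0 < δ + ε * s := fun s hs => by
      have := (hsub hs).1; positivity
    have hge : ∀ s ∈ Set.Icc a b, 0 < ‖e s‖ := by
      intro s hs
      rcases hs.1.lt_or_eq with h | h
      · exact (hm s hs).trans (hgt' s ⟨h, hs.2⟩)
      · subst h; rw [haeq]; exact hm _ hs
    have hfin := sub_le_integral_of_hasDeriv_right_of_le (a := a) (b := b)
      (g := fun s => (1/2) * Real.log (‖e s‖ ^ 2) - Real.log (δ + ε * s))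
      (g' := fun s => (1/2) * ((2 * inner ℝ (e s) (e' s)) / ‖e s‖ ^ 2) - ε / (δ + ε * s))
      (φ := L) hab.le ?_ ?_ (hLi.mono_set hsub) ?_
    · simp only [Real.log_pow, haeq] at hfin
      have h2 : Real.log ‖e b‖ - Real.log (δ + ε * b) ≤ ∫ s in (0:ℝ)..b, L s := by
        have h3 : ∫ s in a..b, L s ≤ ∫ s in (0:ℝ)..b, L s := by
          apply intervalIntegral.integral_mono_interval ha.1 hab.le le_rfl
          · exact (ae_restrict_iff' measurableSet_Ioc).2
              (Filter.Eventually.of_forall fun s hs => hL s ⟨hs.1.le, hs.2⟩)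
          · exact (intervalIntegrable_iff_integrableOn_Icc_of_le hb).2 hLi
        push_cast at hfin
        linarith
      rw [← Real.log_div (by linarith) hmb.ne', Real.log_le_iff_le_exp (by apply div_pos <;> linarith),
        div_le_iff₀ hmb] at h2
      linarith
    · refine ContinuousOn.sub (continuousOn_const.mul (ContinuousOn.log ((hc.mono hsub).norm.pow 2)
        fun s hs => (pow_pos (hge s hs) 2).ne')) (ContinuousOn.log (by fun_prop)
        fun s hs => (hm s hs).ne')
    · intro s hs
      have hs' := Set.Ioo_subset_Icc_self hs
      have h1 := (hd s ⟨ha.1.trans_lt hs.1, hs.2⟩).norm_sq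
      have h2 := (h1.log (pow_pos (hge s hs') 2).ne').const_mul (1/2)
      have h3 : HasDerivAt (fun s => δ + ε * s) ε s := by
        simpa using ((hasDerivAt_id s).const_mul ε).const_add δ
      exact (h2.sub (h3.log (hm s hs').ne')).hasDerivWithinAt
    · intro s hs
      have hs' := Set.Ioo_subset_Icc_self hs
      have hp := hge s hs'
      have hmp := hm s hs'
      have h1 := hbd s ⟨ha.1.trans_lt hs.1, hs.2⟩
      have h2 := real_inner_le_norm (e s) (e' s)
      have h3 := hgt' s ⟨hs.1, hs.2.le⟩
      have h4 : (1/2) * ((2 * inner ℝ (e s) (e' s)) / ‖e s‖ ^ 2) ≤ L s + ε / ‖e s‖ := by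
        have : L s + ε / ‖e s‖ = (‖e s‖ * (L s * ‖e s‖ + ε)) / ‖e s‖ ^ 2 := by
          field_simp
        rw [this, ← mul_div_assoc]
        have h6 := mul_le_mul_of_nonneg_left h1 hp.le
        exact div_le_div_of_nonneg_right (by linarith) (by positivity)
      have h5 : ε / ‖e s‖ ≤ ε / (δ + ε * s) := by gcongr
      linarith
  refine le_of_forall_pos_le_add fun η hη => ?_
  have hE : 0 < Real.exp (∫ s in (0 : ℝ)..b, L s) := Real.exp_pos _
  have := key (η / Real.exp (∫ s in (0 : ℝ)..b, L s)) (by positivity)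
  rw [add_mul, div_mul_cancel₀ _ hE.ne'] at this
  linarith


open MeasureTheory intervalIntegral

/-- Continuous-time approximation of the output process of the RNN-ODE model
(Theorem 2 of the paper): under the uniform approximation bounds for `f_θ` and `g_φ`, a
time-dependent Lipschitz bound `L s` for `f` in its first argument and the smallness
condition `T·ε_f·exp(∫₀ᵀ L) < 0.1`, the neural output `y_NN = g_φ ∘ h_NN` satisfies
`‖y(t) − y_NN(t)‖ ≤ ε_g + L_g·T·exp(∫₀ᵀ L)·ε_f` on `[0, T]`. -/
theorem rnn_ode_output_approximation
    (dh D D' : ℕ) (hdh : 0 < dh) (hD : 0 < D) (hD' : 0 < D') (T : ℝ) (hT : 0 < T)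
    (x : ℝ → EuclideanSpace ℝ (Fin D))
    (hx_cont : ContinuousOn x (Set.Icc 0 T))
    (hx_range : ∀ t ∈ Set.Icc 0 T, ∀ j, |x t j| ≤ 1)
    (f fθ : EuclideanSpace ℝ (Fin dh) → EuclideanSpace ℝ (Fin D) → EuclideanSpace ℝ (Fin dh))
    (hf_cont : Continuous fun p : EuclideanSpace ℝ (Fin dh) × EuclideanSpace ℝ (Fin D) => f p.1 p.2)
    (hfθ_cont : Continuous fun p : EuclideanSpace ℝ (Fin dh) × EuclideanSpace ℝ (Fin D) => fθ p.1 p.2)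
    (h hNN : ℝ → EuclideanSpace ℝ (Fin dh))
    (h0 : h 0 = hNN 0)
    (hh_deriv : ∀ t ∈ Set.Icc 0 T, HasDerivWithinAt h (f (h t) (x t)) (Set.Icc 0 T) t)
    (hh_range : ∀ t ∈ Set.Icc 0 T, ∀ i, |h t i| ≤ 1)
    (hNN_deriv : ∀ t ∈ Set.Icc 0 T, HasDerivWithinAt hNN (fθ (hNN t) (x t)) (Set.Icc 0 T) t)
    (L : ℝ → ℝ)
    (hL_nonneg : ∀ s ∈ Set.Icc 0 T, 0 ≤ L s)
    (hL_int : IntegrableOn L (Set.Icc 0 T))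
    (hLip : ∀ s ∈ Set.Icc 0 T, ∀ η₁ η₂ : EuclideanSpace ℝ (Fin dh),
      (∀ i, |η₁ i| ≤ 1.1) → (∀ i, |η₂ i| ≤ 1.1) →
      ‖f η₁ (x s) - f η₂ (x s)‖ ≤ L s * ‖η₁ - η₂‖)
    (εf : ℝ) (hεf_pos : 0 < εf)
    (hεf : ∀ η : EuclideanSpace ℝ (Fin dh), ∀ ξ : EuclideanSpace ℝ (Fin D),
      (∀ i, |η i| ≤ 1.1) → (∀ j, |ξ j| ≤ 1) → ‖f η ξ - fθ η ξ‖ ≤ εf)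
    (hsmall : T * εf * Real.exp (∫ s in (0 : ℝ)..T, L s) < 0.1)
    (g gφ : EuclideanSpace ℝ (Fin dh) → EuclideanSpace ℝ (Fin D'))
    (Lg : ℝ) (hLg : 0 ≤ Lg)
    (hgLip : ∀ η₁ η₂ : EuclideanSpace ℝ (Fin dh),
      (∀ i, |η₁ i| ≤ 1.1) → (∀ i, |η₂ i| ≤ 1.1) → ‖g η₁ - g η₂‖ ≤ Lg * ‖η₁ - η₂‖)
    (εg : ℝ) (hεg_pos : 0 < εg)
    (hεg : ∀ η : EuclideanSpace ℝ (Fin dh), (∀ i, |η i| ≤ 1.1) → ‖g η - gφ η‖ ≤ εg) :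
    ∀ t ∈ Set.Icc 0 T,
      ‖g (h t) - gφ (hNN t)‖ ≤ εg + Lg * T * Real.exp (∫ s in (0 : ℝ)..T, L s) * εf := by
  have hc : ContinuousOn (fun t => h t - hNN t) (Set.Icc 0 T) :=
    ContinuousOn.sub (fun t ht => (hh_deriv t ht).continuousWithinAt)
      (fun t ht => (hNN_deriv t ht).continuousWithinAt)
  have hcube : ∀ t ∈ Set.Icc 0 T, ‖h t - hNN t‖ ≤ 0.1 → ∀ i, |hNN t i| ≤ 1.1 := by
    intro t ht hle i
    have h1 := hh_range t ht i
    have h2 : |(h t - hNN t) i| ≤ 0.1 := by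
      have := PiLp.norm_apply_le (h t - hNN t) i
      rw [Real.norm_eq_abs] at this
      exact this.trans hle
    rw [PiLp.sub_apply] at h2
    rw [abs_le] at *
    constructor <;> norm_num at * <;> linarith
  have hcube' : ∀ t ∈ Set.Icc 0 T, ∀ i, |h t i| ≤ 1.1 := fun t ht i =>
    (hh_range t ht i).trans (by norm_num)
  have step : ∀ b ∈ Set.Icc 0 T, (∀ t ∈ Set.Ioo 0 b, ‖h t - hNN t‖ ≤ 0.1) →
      ‖h b - hNN b‖ ≤ T * εf * Real.exp (∫ s in (0 : ℝ)..T, L s) := by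
    intro b hb hlt
    have hsub : Set.Icc 0 b ⊆ Set.Icc 0 T := Set.Icc_subset_Icc_right hb.2
    have := gron_aux (fun t => h t - hNN t) (fun t => f (h t) (x t) - fθ (hNN t) (x t)) L b εf
      hb.1 hεf_pos (hc.mono hsub) (by simp [h0]) ?_ ?_ (fun t ht => hL_nonneg t (hsub ht))
      (hL_int.mono_set hsub)
    · refine this.trans ?_
      have h3 : ∫ s in (0:ℝ)..b, L s ≤ ∫ s in (0:ℝ)..T, L s := by
        apply intervalIntegral.integral_mono_interval le_rfl hb.1 hb.2
        · exact (ae_restrict_iff' measurableSet_Ioc).2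
            (Filter.Eventually.of_forall fun s hs => hL_nonneg s ⟨hs.1.le, hs.2⟩)
        · exact (intervalIntegrable_iff_integrableOn_Icc_of_le hT.le).2 hL_int
      rw [mul_comm εf b]
      have := hb.2
      gcongr
    · intro t ht
      have ht' := hsub (Set.Ioo_subset_Icc_self ht)
      have hn : Set.Icc 0 T ∈ nhds t := Icc_mem_nhds ht.1 (ht.2.trans_le hb.2)
      exact ((hh_deriv t ht').hasDerivAt hn).sub ((hNN_deriv t ht').hasDerivAt hn)
    · intro t ht
      have ht' := hsub (Set.Ioo_subset_Icc_self ht)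
      have hN := hcube t ht' (hlt t ht)
      have h1 := hLip t ht' _ _ (hcube' t ht') hN
      have h2 := hεf _ _ hN (hx_range t ht')
      have h3 := norm_sub_le_norm_sub_add_norm_sub (f (h t) (x t)) (f (hNN t) (x t))
        (fθ (hNN t) (x t))
      linarith
  have hall : ∀ t ∈ Set.Icc 0 T, ‖h t - hNN t‖ ≤ 0.1 := by
    by_contra! hex
    obtain ⟨t, ht, hgt⟩ := hex
    have hScl : IsCompact (Set.Icc 0 T ∩ (fun s => ‖h s - hNN s‖) ⁻¹' Set.Ici 0.1) :=
      isCompact_Icc.of_isClosed_subset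
        (hc.norm.preimage_isClosed_of_isClosed isClosed_Icc isClosed_Ici) Set.inter_subset_left
    obtain ⟨b, ⟨hb, hbS⟩, hbl⟩ := hScl.exists_isLeast ⟨t, ht, hgt.le⟩
    have := step b hb (fun s hs => by
      by_contra! hlt
      have := hbl ⟨⟨hs.1.le, hs.2.le.trans hb.2⟩, hlt.le⟩
      linarith [hs.2])
    simp only [Set.mem_preimage, Set.mem_Ici] at hbS
    linarith
  intro t ht
  have h1 := step t ht (fun s hs => hall s ⟨hs.1.le, hs.2.le.trans ht.2⟩)
  have hN := hcube t ht (hall t ht)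
  have h2 := hgLip _ _ (hcube' t ht) hN
  have h3 := hεg _ hN
  have h4 := norm_sub_le_norm_sub_add_norm_sub (g (h t)) (g (hNN t)) (gφ (hNN t))
  have h5 := mul_le_mul_of_nonneg_left h1 hLg
  linarith
end

section
/- Let d_h, D be positive integers and T > 0. Equip ℝ^{d_h} and ℝ^D with the Euclidean norm, and write [−1,1]^{d_h} (resp. [−1.1,1.1]^{d_h}, [−1,1]^D) for the set of vectors all of whose coordinates lie in the indicated interval. Let 0 = t_0 < t_1 < ⋯ < t_N ≤ T be a time grid with step sizes Δt_i = t_i − t_{i−1}. Let x : [0, T] → ℝ^D with x(t) ∈ [−1,1]^D for all t, let f, f_θ : ℝ^{d_h} × ℝ^D → ℝ^{d_h} be continuous, and let h : [0, T] → ℝ^{d_h} be differentiable with h'(t) = f(h(t), x(t)) and h(t) ∈ [−1,1]^{d_h} for all t ∈ [0, T]. For each i = 1, …, N suppose there are sets B_i^h ⊆ [−1.1,1.1]^{d_h} and B_i^x ⊆ [−1,1]^D such that every η ∈ ℝ^{d_h} with ‖η − h(s)‖ ≤ 0.1 for some s ∈ [t_{i−1}, t_i] belongs to B_i^h, and every ξ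 ∈ [−1,1]^D with ‖ξ − x(s)‖ ≤ 0.1 for some s ∈ [t_{i−1}, t_i] belongs to B_i^x, and constants L_i^{f,h}, L_i^{f,x}, M_i^f, L_i^x ≥ 0 such that: ‖f(η₁, ξ) − f(η₂, ξ)‖ ≤ L_i^{f,h}·‖η₁ − η₂‖ for η₁, η₂ ∈ B_i^h, ξ ∈ B_i^x; ‖f(η, ξ₁) − f(η, ξ₂)‖ ≤ L_i^{f,x}·‖ξ₁ − ξ₂‖ for η ∈ B_i^h, ξ₁, ξ₂ ∈ B_i^x; ‖f(η, ξ)‖ ≤ M_i^f on B_i^h × B_i^x; and ‖x(s) − x(s')‖ ≤ L_i^x·|s − s'| for s, s' ∈ [t_{i−1}, t_i]. Let ε_f > 0 satisfy ‖f(η, ξ) − f_θ(η, ξ)‖ ≤ ε_f for all η ∈ [−1.1,1.1]^{d_h}, ξ ∈ [−1,1]^D. Define the forward-Euler iterates ĥ(t_0) = h(0) and ĥ(t_i) = ĥ(t_{i−1}) + Δt_i·f_θ(ĥ(t_{i−1}), x(t_{i−1})) for i = 1, …, N, and set μ_j = L_j^{f,h}·M_j^f + L_j^{f,x}·L_j^x.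 If T·exp(Σ_{i=1}^N L_i^{f,h}·Δt_i)·(ε_f + max_{1≤j≤N} μ_j·Δt_j) < 0.1, then for every i = 0, 1, …, N, ‖h(t_i) − ĥ(t_i)‖ ≤ T·exp(Σ_{i=1}^N L_i^{f,h}·Δt_i)·(ε_f + max_{1≤j≤N} μ_j·Δt_j) < 0.1; in particular ĥ(t_i) ∈ [−1.1,1.1]^{d_h} for every i. -/
/-- Hidden-state approximation of the RNN-ODE model under forward-Euler time
discretization (the hidden-state part of Theorem 3 of the paper): under local Lipschitz
and boundedness constants on neighborhoods `B_i^h`, `B_i^x` of the trajectories, the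
uniform approximation bound `ε_f` for `f_θ`, and the smallness condition
`T·exp(Σ L_i^{f,h}·Δt_i)·(ε_f + max_j μ_j·Δt_j) < 0.1`, the Euler iterates satisfy
`‖h(t_i) − ĥ(t_i)‖ ≤ T·exp(Σ L_i^{f,h}·Δt_i)·(ε_f + max_j μ_j·Δt_j) < 0.1` and remain
in `[−1.1,1.1]^{d_h}`. -/
theorem euler_hidden_state_approximation
    (dh D : ℕ) (hdh : 0 < dh) (hD : 0 < D) (T : ℝ) (hT : 0 < T)
    (N : ℕ) (hN : 0 < N) (t : ℕ → ℝ)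
    (ht0 : t 0 = 0) (ht_mono : ∀ i < N, t i < t (i + 1)) (htN : t N ≤ T)
    (x : ℝ → EuclideanSpace ℝ (Fin D))
    (hx_range : ∀ s ∈ Set.Icc 0 T, ∀ j, |x s j| ≤ 1)
    (f fθ : EuclideanSpace ℝ (Fin dh) → EuclideanSpace ℝ (Fin D) → EuclideanSpace ℝ (Fin dh))
    (hf_cont : Continuous fun p : EuclideanSpace ℝ (Fin dh) × EuclideanSpace ℝ (Fin D) => f p.1 p.2)
    (hfθ_cont : Continuous fun p : EuclideanSpace ℝ (Fin dh) × EuclideanSpace ℝ (Fin D) => fθ p.1 p.2)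
    (h : ℝ → EuclideanSpace ℝ (Fin dh))
    (hh_deriv : ∀ s ∈ Set.Icc 0 T, HasDerivWithinAt h (f (h s) (x s)) (Set.Icc 0 T) s)
    (hh_range : ∀ s ∈ Set.Icc 0 T, ∀ i, |h s i| ≤ 1)
    (Bh : ℕ → Set (EuclideanSpace ℝ (Fin dh))) (Bx : ℕ → Set (EuclideanSpace ℝ (Fin D)))
    (hBh_sub : ∀ i ∈ Finset.Icc 1 N, ∀ η ∈ Bh i, ∀ j, |η j| ≤ 1.1)
    (hBx_sub : ∀ i ∈ Finset.Icc 1 N, ∀ ξ ∈ Bx i, ∀ j, |ξ j| ≤ 1)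
    (hBh_nbhd : ∀ i ∈ Finset.Icc 1 N, ∀ η : EuclideanSpace ℝ (Fin dh),
      (∃ s ∈ Set.Icc (t (i - 1)) (t i), ‖η - h s‖ ≤ 0.1) → η ∈ Bh i)
    (hBx_nbhd : ∀ i ∈ Finset.Icc 1 N, ∀ ξ : EuclideanSpace ℝ (Fin D), (∀ j, |ξ j| ≤ 1) →
      (∃ s ∈ Set.Icc (t (i - 1)) (t i), ‖ξ - x s‖ ≤ 0.1) → ξ ∈ Bx i)
    (Lfh Lfx Mf Lx : ℕ → ℝ)
    (hLfh_nonneg : ∀ i, 0 ≤ Lfh i) (hLfx_nonneg : ∀ i, 0 ≤ Lfx i)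
    (hMf_nonneg : ∀ i, 0 ≤ Mf i) (hLx_nonneg : ∀ i, 0 ≤ Lx i)
    (hLiph : ∀ i ∈ Finset.Icc 1 N, ∀ η₁ ∈ Bh i, ∀ η₂ ∈ Bh i, ∀ ξ ∈ Bx i,
      ‖f η₁ ξ - f η₂ ξ‖ ≤ Lfh i * ‖η₁ - η₂‖)
    (hLipx : ∀ i ∈ Finset.Icc 1 N, ∀ η ∈ Bh i, ∀ ξ₁ ∈ Bx i, ∀ ξ₂ ∈ Bx i,
      ‖f η ξ₁ - f η ξ₂‖ ≤ Lfx i * ‖ξ₁ - ξ₂‖)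
    (hMf : ∀ i ∈ Finset.Icc 1 N, ∀ η ∈ Bh i, ∀ ξ ∈ Bx i, ‖f η ξ‖ ≤ Mf i)
    (hxLip : ∀ i ∈ Finset.Icc 1 N, ∀ s ∈ Set.Icc (t (i - 1)) (t i),
      ∀ s' ∈ Set.Icc (t (i - 1)) (t i), ‖x s - x s'‖ ≤ Lx i * |s - s'|)
    (εf : ℝ) (hεf_pos : 0 < εf)
    (hεf : ∀ η : EuclideanSpace ℝ (Fin dh), ∀ ξ : EuclideanSpace ℝ (Fin D),
      (∀ i, |η i| ≤ 1.1) → (∀ j, |ξ j| ≤ 1) → ‖f η ξ - fθ η ξ‖ ≤ εf)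
    (hhat : ℕ → EuclideanSpace ℝ (Fin dh))
    (hhat0 : hhat 0 = h 0)
    (hhat_rec : ∀ i, 1 ≤ i → i ≤ N →
      hhat i = hhat (i - 1) + (t i - t (i - 1)) • fθ (hhat (i - 1)) (x (t (i - 1))))
    (hsmall :
      T * Real.exp (∑ i ∈ Finset.Icc 1 N, Lfh i * (t i - t (i - 1)))
        * (εf + (Finset.Icc 1 N).sup' (Finset.nonempty_Icc.mpr hN)
            (fun j => (Lfh j * Mf j + Lfx j * Lx j) * (t j - t (j - 1)))) < 0.1) :
    (∀ i ≤ N,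
      ‖h (t i) - hhat i‖
        ≤ T * Real.exp (∑ i ∈ Finset.Icc 1 N, Lfh i * (t i - t (i - 1)))
            * (εf + (Finset.Icc 1 N).sup' (Finset.nonempty_Icc.mpr hN)
                (fun j => (Lfh j * Mf j + Lfx j * Lx j) * (t j - t (j - 1)))))
    ∧ (∀ i ≤ N, ∀ j, |hhat i j| ≤ 1.1) := by
  set K := (Finset.Icc 1 N).sup' (Finset.nonempty_Icc.mpr hN)
      (fun j => (Lfh j * Mf j + Lfx j * Lx j) * (t j - t (j - 1))) with hK
  set S : ℕ → ℝ := fun n => ∑ i ∈ Finset.Icc 1 n, Lfh i * (t i - t (i - 1)) with hS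
  change T * Real.exp (S N) * (εf + K) < 0.1 at hsmall
  change (∀ i ≤ N, ‖h (t i) - hhat i‖ ≤ T * Real.exp (S N) * (εf + K)) ∧ _
  have hKj : ∀ j ∈ Finset.Icc 1 N, (Lfh j * Mf j + Lfx j * Lx j) * (t j - t (j - 1)) ≤ K := by
    intro j hj
    exact Finset.le_sup' (fun j => (Lfh j * Mf j + Lfx j * Lx j) * (t j - t (j - 1))) hj
  have hμ : ∀ j, 0 ≤ Lfh j * Mf j + Lfx j * Lx j := fun j =>
    add_nonneg (mul_nonneg (hLfh_nonneg j) (hMf_nonneg j))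
      (mul_nonneg (hLfx_nonneg j) (hLx_nonneg j))
  have hK0 : 0 ≤ K := by
    have h1 := hKj 1 (Finset.mem_Icc.mpr ⟨le_rfl, hN⟩)
    have h2 := ht_mono 0 hN
    have h3 : 0 ≤ (Lfh 1 * Mf 1 + Lfx 1 * Lx 1) * (t 1 - t (1 - 1)) :=
      mul_nonneg (hμ 1) (by simpa using h2.le)
    linarith
  have hC : 0 < εf + K := by linarith
  have ht_le : ∀ m n, m ≤ n → n ≤ N → t m ≤ t n := by
    intro m n hmn
    induction n, hmn using Nat.le_induction with
    | base => intro _; exact le_rfl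
    | succ n hmn ih =>
      intro hn
      exact (ih (by omega)).trans (ht_mono n (by omega)).le
  have ht_nonneg : ∀ n ≤ N, 0 ≤ t n := fun n hn => ht0 ▸ ht_le 0 n (Nat.zero_le _) hn
  have ht_T : ∀ n ≤ N, t n ≤ T := fun n hn => (ht_le n N hn le_rfl).trans htN
  have hSs : ∀ n, S (n + 1) = S n + Lfh (n + 1) * (t (n + 1) - t n) := by
    intro n
    simp only [hS]
    rw [Finset.sum_Icc_succ_top (by omega)]
    simp
  have hS_le : ∀ m ≤ N, S m ≤ S N := by
    intro m hm
    apply Finset.sum_le_sum_of_subset_of_nonneg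
    · exact Finset.Icc_subset_Icc le_rfl hm
    · intro i hi _
      rw [Finset.mem_Icc] at hi
      exact mul_nonneg (hLfh_nonneg i) (sub_nonneg.mpr (ht_le _ _ (by omega) hi.2))
  have hbound : ∀ n ≤ N, t n * Real.exp (S n) * (εf + K) ≤ T * Real.exp (S N) * (εf + K) := by
    intro n hn
    have h1 := Real.exp_le_exp.mpr (hS_le n hn)
    have h2 := ht_T n hn
    gcongr
  have main : ∀ n ≤ N, ‖h (t n) - hhat n‖ ≤ t n * Real.exp (S n) * (εf + K) := by
    intro n
    induction n with
    | zero => intro _; simp [ht0, hhat0]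
    | succ n ih =>
      intro hn
      have ih := ih (by omega)
      have he : ‖h (t n) - hhat n‖ ≤ 0.1 :=
        (ih.trans (hbound n (by omega))).trans hsmall.le
      have hk : n + 1 ∈ Finset.Icc 1 N := Finset.mem_Icc.mpr ⟨by omega, hn⟩
      have hlt := ht_mono n (by omega)
      have hBh' := hBh_nbhd _ hk
      have hBx' := hBx_nbhd _ hk
      have hLh' := hLiph _ hk
      have hLx' := hLipx _ hk
      have hM' := hMf _ hk
      have hxL := hxLip _ hk
      have hrec := hhat_rec (n + 1) (by omega) hn
      have hKk := hKj _ hk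
      simp only [Nat.add_sub_cancel] at hBh' hBx' hxL hrec hKk
      have hsub : Set.Icc (t n) (t (n + 1)) ⊆ Set.Icc 0 T :=
        Set.Icc_subset_Icc (ht_nonneg n (by omega)) (ht_T _ hn)
      have ha : t n ∈ Set.Icc (t n) (t (n + 1)) := ⟨le_rfl, hlt.le⟩
      have hb : t (n + 1) ∈ Set.Icc (t n) (t (n + 1)) := ⟨hlt.le, le_rfl⟩
      have hhB : ∀ s ∈ Set.Icc (t n) (t (n + 1)), h s ∈ Bh (n + 1) := fun s hs =>
        hBh' _ ⟨s, hs, by simp; norm_num⟩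
      have hxB : ∀ s ∈ Set.Icc (t n) (t (n + 1)), x s ∈ Bx (n + 1) := fun s hs =>
        hBx' _ (hx_range s (hsub hs)) ⟨s, hs, by simp; norm_num⟩
      have hhatB : hhat n ∈ Bh (n + 1) := hBh' _ ⟨t n, ha, by rwa [norm_sub_rev]⟩
      have hd : ∀ s ∈ Set.Icc (t n) (t (n + 1)),
          HasDerivWithinAt h (f (h s) (x s)) (Set.Icc (t n) (t (n + 1))) s := fun s hs =>
        (hh_deriv s (hsub hs)).mono hsub
      have hhL : ∀ s ∈ Set.Icc (t n) (t (n + 1)),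
          ‖h s - h (t n)‖ ≤ Mf (n + 1) * (s - t n) := by
        intro s hs
        have := (convex_Icc (t n) (t (n + 1))).norm_image_sub_le_of_norm_hasDerivWithin_le hd
          (fun s hs => hM' _ (hhB s hs) _ (hxB s hs)) ha hs
        rwa [Real.norm_of_nonneg (sub_nonneg.mpr hs.1)] at this
      set v := f (h (t n)) (x (t n)) with hv
      have hfd : ∀ s ∈ Set.Icc (t n) (t (n + 1)), ‖f (h s) (x s) - v‖ ≤ K := by
        intro s hs
        have h1 := hLh' _ (hhB s hs) _ (hhB _ ha) _ (hxB s hs)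
        have h2 := hLx' _ (hhB _ ha) _ (hxB s hs) _ (hxB _ ha)
        have h3 := hxL s hs _ ha
        rw [abs_of_nonneg (sub_nonneg.mpr hs.1)] at h3
        have h4 := mul_le_mul_of_nonneg_left (hhL s hs) (hLfh_nonneg (n + 1))
        have h5 := mul_le_mul_of_nonneg_left h3 (hLfx_nonneg (n + 1))
        have h6 := mul_le_mul_of_nonneg_left (sub_le_sub_right hs.2 (t n)) (hμ (n + 1))
        have h7 := norm_sub_le_norm_sub_add_norm_sub (f (h s) (x s)) (f (h (t n)) (x s)) v
        linarith
      have hloc : ‖h (t (n + 1)) - h (t n) - (t (n + 1) - t n) • v‖ ≤ K * (t (n + 1) - t n) := by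
        have hg : ∀ s ∈ Set.Icc (t n) (t (n + 1)),
            HasDerivWithinAt (fun s => h s - s • v) (f (h s) (x s) - v)
              (Set.Icc (t n) (t (n + 1))) s := by
          intro s hs
          have := (hd s hs).sub ((hasDerivWithinAt_id s _).smul_const v)
          rw [one_smul] at this
          exact this
        have := (convex_Icc (t n) (t (n + 1))).norm_image_sub_le_of_norm_hasDerivWithin_le hg
          hfd ha hb
        rw [Real.norm_of_nonneg (sub_nonneg.mpr hlt.le)] at this
        have heq0 : h (t (n + 1)) - h (t n) - (t (n + 1) - t n) • v
            = h (t (n + 1)) - t (n + 1) • v - (h (t n) - t n • v) := by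
          rw [sub_smul]; abel
        rw [heq0]
        exact this
      have hA := hLh' _ (hhB _ ha) _ hhatB _ (hxB _ ha)
      have hE := hεf (hhat n) (x (t n)) (hBh_sub _ hk _ hhatB) (hx_range _ (hsub ha))
      have hvd : ‖v - fθ (hhat n) (x (t n))‖ ≤ Lfh (n + 1) * ‖h (t n) - hhat n‖ + εf :=
        (norm_sub_le_norm_sub_add_norm_sub _ (f (hhat n) (x (t n))) _).trans (add_le_add hA hE)
      set Δ := t (n + 1) - t n with hΔ
      have hΔ0 : 0 ≤ Δ := sub_nonneg.mpr hlt.le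
      have heq : h (t (n + 1)) - hhat (n + 1) = (h (t n) - hhat n)
          + (h (t (n + 1)) - h (t n) - Δ • v) + Δ • (v - fθ (hhat n) (x (t n))) := by
        rw [hrec, smul_sub]; abel
      have hstep : ‖h (t (n + 1)) - hhat (n + 1)‖ ≤
          (Lfh (n + 1) * Δ + 1) * ‖h (t n) - hhat n‖ + Δ * (εf + K) := by
        rw [heq]
        refine norm_add₃_le.trans ?_
        rw [norm_smul, Real.norm_of_nonneg hΔ0]
        have := mul_le_mul_of_nonneg_left hvd hΔ0
        linarith
      have hexp := Real.add_one_le_exp (Lfh (n + 1) * Δ)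
      have hSn0 : 0 ≤ S (n + 1) := by
        apply Finset.sum_nonneg
        intro i hi
        rw [Finset.mem_Icc] at hi
        exact mul_nonneg (hLfh_nonneg i) (sub_nonneg.mpr (ht_le _ _ (by omega) (by omega)))
      have h1e : 1 ≤ Real.exp (S (n + 1)) := Real.one_le_exp hSn0
      calc _ ≤ _ := hstep
        _ ≤ Real.exp (Lfh (n + 1) * Δ) * (t n * Real.exp (S n) * (εf + K))
            + Δ * (εf + K) * Real.exp (S (n + 1)) := by
          apply add_le_add
          · exact mul_le_mul hexp ih (norm_nonneg _) (Real.exp_pos _).le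
          · exact le_mul_of_one_le_right (by positivity) h1e
        _ = t (n + 1) * Real.exp (S (n + 1)) * (εf + K) := by
          rw [hSs n, Real.exp_add, hΔ]; ring
  have fin : ∀ i ≤ N, ‖h (t i) - hhat i‖ ≤ T * Real.exp (S N) * (εf + K) := fun i hi =>
    (main i hi).trans (hbound i hi)
  refine ⟨fin, fun i hi j => ?_⟩
  have h1 := (fin i hi).trans hsmall.le
  have h2 := hh_range (t i) ⟨ht_nonneg i hi, ht_T i hi⟩ j
  have h3 := PiLp.norm_apply_le (h (t i) - hhat i) j
  rw [PiLp.sub_apply, Real.norm_eq_abs] at h3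
  have h4 := abs_le.mp (h3.trans h1)
  have h5 := abs_le.mp h2
  rw [abs_le]
  norm_num at *
  constructor <;> linarith [h4.1, h4.2, h5.1, h5.2]
end

section
/- Let d_h, D, D' be positive integers and T > 0. Equip ℝ^{d_h}, ℝ^D, ℝ^{D'} with the Euclidean norm, and write [−1,1]^{d_h} (resp. [−1.1,1.1]^{d_h}, [−1,1]^D) for the set of vectors all of whose coordinates lie in the indicated interval. Let 0 = t_0 < t_1 < ⋯ < t_N ≤ T be a time grid with step sizes Δt_i = t_i − t_{i−1}. Let x : [0, T] → ℝ^D with x(t) ∈ [−1,1]^D for all t, let f, f_θ : ℝ^{d_h} × ℝ^D → ℝ^{d_h} be continuous, and let h : [0, T] → ℝ^{d_h} be differentiable with h'(t) = f(h(t), x(t)) and h(t) ∈ [−1,1]^{d_h} for all t ∈ [0, T]. For each i = 1, …, N suppose there are sets B_i^h ⊆ [−1.1,1.1]^{d_h} and B_i^x ⊆ [−1,1]^D such that every η ∈ ℝ^{d_h} with ‖η − h(s)‖ ≤ 0.1 for some s ∈ [t_{i−1}, t_i] belongs to B_i^h, and every ξ ∈ [−1,1]^D with ‖ξ − x(s)‖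 ≤ 0.1 for some s ∈ [t_{i−1}, t_i] belongs to B_i^x, and constants L_i^{f,h}, L_i^{f,x}, M_i^f, L_i^x ≥ 0 such that: ‖f(η₁, ξ) − f(η₂, ξ)‖ ≤ L_i^{f,h}·‖η₁ − η₂‖ for η₁, η₂ ∈ B_i^h, ξ ∈ B_i^x; ‖f(η, ξ₁) − f(η, ξ₂)‖ ≤ L_i^{f,x}·‖ξ₁ − ξ₂‖ for η ∈ B_i^h, ξ₁, ξ₂ ∈ B_i^x; ‖f(η, ξ)‖ ≤ M_i^f on B_i^h × B_i^x; and ‖x(s) − x(s')‖ ≤ L_i^x·|s − s'| for s, s' ∈ [t_{i−1}, t_i]. Let ε_f > 0 satisfy ‖f(η, ξ) − f_θ(η, ξ)‖ ≤ ε_f for all η ∈ [−1.1,1.1]^{d_h}, ξ ∈ [−1,1]^D. Furthermore, let g, g_φ : ℝ^{d_h} → ℝ^{D'}, let L_g ≥ 0 be such that ‖g(η₁) − g(η₂)‖ ≤ L_g·‖η₁ − η₂‖ for all η₁, η₂ ∈ [−1.1,1.1]^{d_h}, and let ε_g > 0 satisfy ‖g(η) − g_φ(η)‖ ≤ ε_g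 for all η ∈ [−1.1,1.1]^{d_h}. Define the forward-Euler iterates ĥ(t_0) = h(0) and ĥ(t_i) = ĥ(t_{i−1}) + Δt_i·f_θ(ĥ(t_{i−1}), x(t_{i−1})), and outputs ŷ(t_i) = g_φ(ĥ(t_i)), for i = 1, …, N, and set μ_j = L_j^{f,h}·M_j^f + L_j^{f,x}·L_j^x. If T·exp(Σ_{i=1}^N L_i^{f,h}·Δt_i)·(ε_f + max_{1≤j≤N} μ_j·Δt_j) < 0.1, then max_{1≤i≤N} ‖g(h(t_i)) − ŷ(t_i)‖ ≤ ε_g + L_g·T·exp(Σ_{i=1}^N L_i^{f,h}·Δt_i)·(ε_f + max_{1≤j≤N} μ_j·Δt_j). -/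
/-- Output approximation of the RNN-ODE model under forward-Euler time discretization
(Theorem 3 of the paper): under local Lipschitz and boundedness constants on
neighborhoods `B_i^h`, `B_i^x` of the trajectories, uniform approximation bounds `ε_f`
for `f_θ` and `ε_g` for `g_φ`, a Lipschitz constant `L_g` for `g` on `[−1.1,1.1]^{d_h}`,
and the smallness condition `T·exp(Σ L_i^{f,h}·Δt_i)·(ε_f + max_j μ_j·Δt_j) < 0.1`, the
Euler-scheme outputs satisfy
`‖g(h(t_i)) − ŷ(t_i)‖ ≤ ε_g + L_g·T·exp(Σ L_i^{f,h}·Δt_i)·(ε_f + max_j μ_j·Δt_j)`. -/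
theorem euler_output_approximation
    (dh D D' : ℕ) (hdh : 0 < dh) (hD : 0 < D) (hD' : 0 < D') (T : ℝ) (hT : 0 < T)
    (N : ℕ) (hN : 0 < N) (t : ℕ → ℝ)
    (ht0 : t 0 = 0) (ht_mono : ∀ i < N, t i < t (i + 1)) (htN : t N ≤ T)
    (x : ℝ → EuclideanSpace ℝ (Fin D))
    (hx_range : ∀ s ∈ Set.Icc 0 T, ∀ j, |x s j| ≤ 1)
    (f fθ : EuclideanSpace ℝ (Fin dh) → EuclideanSpace ℝ (Fin D) → EuclideanSpace ℝ (Fin dh))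
    (hf_cont : Continuous fun p : EuclideanSpace ℝ (Fin dh) × EuclideanSpace ℝ (Fin D) => f p.1 p.2)
    (hfθ_cont : Continuous fun p : EuclideanSpace ℝ (Fin dh) × EuclideanSpace ℝ (Fin D) => fθ p.1 p.2)
    (h : ℝ → EuclideanSpace ℝ (Fin dh))
    (hh_deriv : ∀ s ∈ Set.Icc 0 T, HasDerivWithinAt h (f (h s) (x s)) (Set.Icc 0 T) s)
    (hh_range : ∀ s ∈ Set.Icc 0 T, ∀ i, |h s i| ≤ 1)
    (Bh : ℕ → Set (EuclideanSpace ℝ (Fin dh))) (Bx : ℕ → Set (EuclideanSpace ℝ (Fin D)))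
    (hBh_sub : ∀ i ∈ Finset.Icc 1 N, ∀ η ∈ Bh i, ∀ j, |η j| ≤ 1.1)
    (hBx_sub : ∀ i ∈ Finset.Icc 1 N, ∀ ξ ∈ Bx i, ∀ j, |ξ j| ≤ 1)
    (hBh_nbhd : ∀ i ∈ Finset.Icc 1 N, ∀ η : EuclideanSpace ℝ (Fin dh),
      (∃ s ∈ Set.Icc (t (i - 1)) (t i), ‖η - h s‖ ≤ 0.1) → η ∈ Bh i)
    (hBx_nbhd : ∀ i ∈ Finset.Icc 1 N, ∀ ξ : EuclideanSpace ℝ (Fin D), (∀ j, |ξ j| ≤ 1) →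
      (∃ s ∈ Set.Icc (t (i - 1)) (t i), ‖ξ - x s‖ ≤ 0.1) → ξ ∈ Bx i)
    (Lfh Lfx Mf Lx : ℕ → ℝ)
    (hLfh_nonneg : ∀ i, 0 ≤ Lfh i) (hLfx_nonneg : ∀ i, 0 ≤ Lfx i)
    (hMf_nonneg : ∀ i, 0 ≤ Mf i) (hLx_nonneg : ∀ i, 0 ≤ Lx i)
    (hLiph : ∀ i ∈ Finset.Icc 1 N, ∀ η₁ ∈ Bh i, ∀ η₂ ∈ Bh i, ∀ ξ ∈ Bx i,
      ‖f η₁ ξ - f η₂ ξ‖ ≤ Lfh i * ‖η₁ - η₂‖)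
    (hLipx : ∀ i ∈ Finset.Icc 1 N, ∀ η ∈ Bh i, ∀ ξ₁ ∈ Bx i, ∀ ξ₂ ∈ Bx i,
      ‖f η ξ₁ - f η ξ₂‖ ≤ Lfx i * ‖ξ₁ - ξ₂‖)
    (hMf : ∀ i ∈ Finset.Icc 1 N, ∀ η ∈ Bh i, ∀ ξ ∈ Bx i, ‖f η ξ‖ ≤ Mf i)
    (hxLip : ∀ i ∈ Finset.Icc 1 N, ∀ s ∈ Set.Icc (t (i - 1)) (t i),
      ∀ s' ∈ Set.Icc (t (i - 1)) (t i), ‖x s - x s'‖ ≤ Lx i * |s - s'|)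
    (εf : ℝ) (hεf_pos : 0 < εf)
    (hεf : ∀ η : EuclideanSpace ℝ (Fin dh), ∀ ξ : EuclideanSpace ℝ (Fin D),
      (∀ i, |η i| ≤ 1.1) → (∀ j, |ξ j| ≤ 1) → ‖f η ξ - fθ η ξ‖ ≤ εf)
    (g gφ : EuclideanSpace ℝ (Fin dh) → EuclideanSpace ℝ (Fin D'))
    (Lg : ℝ) (hLg : 0 ≤ Lg)
    (hgLip : ∀ η₁ η₂ : EuclideanSpace ℝ (Fin dh),
      (∀ i, |η₁ i| ≤ 1.1) → (∀ i, |η₂ i| ≤ 1.1) → ‖g η₁ - g η₂‖ ≤ Lg * ‖η₁ - η₂‖)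
    (εg : ℝ) (hεg_pos : 0 < εg)
    (hεg : ∀ η : EuclideanSpace ℝ (Fin dh), (∀ i, |η i| ≤ 1.1) → ‖g η - gφ η‖ ≤ εg)
    (hhat : ℕ → EuclideanSpace ℝ (Fin dh))
    (hhat0 : hhat 0 = h 0)
    (hhat_rec : ∀ i, 1 ≤ i → i ≤ N →
      hhat i = hhat (i - 1) + (t i - t (i - 1)) • fθ (hhat (i - 1)) (x (t (i - 1))))
    (yhat : ℕ → EuclideanSpace ℝ (Fin D'))
    (hyhat : ∀ i, 1 ≤ i → i ≤ N → yhat i = gφ (hhat i))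
    (hsmall :
      T * Real.exp (∑ i ∈ Finset.Icc 1 N, Lfh i * (t i - t (i - 1)))
        * (εf + (Finset.Icc 1 N).sup' (Finset.nonempty_Icc.mpr hN)
            (fun j => (Lfh j * Mf j + Lfx j * Lx j) * (t j - t (j - 1)))) < 0.1) :
    ∀ i, 1 ≤ i → i ≤ N →
      ‖g (h (t i)) - yhat i‖
        ≤ εg + Lg * T * Real.exp (∑ i ∈ Finset.Icc 1 N, Lfh i * (t i - t (i - 1)))
            * (εf + (Finset.Icc 1 N).sup' (Finset.nonempty_Icc.mpr hN)
                (fun j => (Lfh j * Mf j + Lfx j * Lx j) * (t j - t (j - 1)))) := by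
  set K := (Finset.Icc 1 N).sup' (Finset.nonempty_Icc.mpr hN)
            (fun j => (Lfh j * Mf j + Lfx j * Lx j) * (t j - t (j - 1))) with hK
  have hKle : ∀ k < N, (Lfh (k+1) * Mf (k+1) + Lfx (k+1) * Lx (k+1)) * (t (k+1) - t k) ≤ K := by
    intro k hk
    have := Finset.le_sup' (s := Finset.Icc 1 N)
      (fun j => (Lfh j * Mf j + Lfx j * Lx j) * (t j - t (j - 1)))
      (show k + 1 ∈ Finset.Icc 1 N from Finset.mem_Icc.mpr ⟨by omega, by omega⟩)
    simpa using this
  have hμ : ∀ k, 0 ≤ Lfh k * Mf k + Lfx k * Lx k := fun k =>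
    add_nonneg (mul_nonneg (hLfh_nonneg k) (hMf_nonneg k))
      (mul_nonneg (hLfx_nonneg k) (hLx_nonneg k))
  have hK0 : 0 ≤ K :=
    le_trans (mul_nonneg (hμ _) (sub_nonneg.mpr (ht_mono 0 hN).le)) (hKle 0 hN)
  have htpos : ∀ k, k ≤ N → 0 ≤ t k := by
    intro k
    induction k with
    | zero => intro _; exact ht0.ge
    | succ k ih => intro hk; linarith [ih (by omega), ht_mono k (by omega)]
  have htT : ∀ k, k ≤ N → t k ≤ T := by
    intro k hk
    refine Nat.decreasingInduction' (P := fun k => t k ≤ T) ?_ hk htN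
    intro j hj _ ih
    exact (ht_mono j hj).le.trans ih
  set S : ℕ → ℝ := fun k => ∑ i ∈ Finset.Icc 1 k, Lfh i * (t i - t (i - 1)) with hS
  have hSsucc : ∀ k, S (k+1) = S k + Lfh (k+1) * (t (k+1) - t k) := by
    intro k
    simp only [hS]
    rw [Finset.sum_Icc_succ_top (by omega)]
    simp
  have hSN : ∀ k, k ≤ N → S k ≤ S N := by
    intro k hk
    refine Nat.decreasingInduction' (P := fun k => S k ≤ S N) ?_ hk le_rfl
    intro j hj _ ih
    have := hSsucc j
    have := mul_nonneg (hLfh_nonneg (j+1)) (sub_nonneg.mpr (ht_mono j hj).le)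
    linarith
  have hS0 : ∀ k, k ≤ N → 0 ≤ S k := by
    intro k
    induction k with
    | zero => intro _; simp [hS]
    | succ k ih =>
      intro hk
      have := hSsucc k
      have := mul_nonneg (hLfh_nonneg (k+1)) (sub_nonneg.mpr (ht_mono k (by omega)).le)
      linarith [ih (by omega)]
  change T * Real.exp (S N) * (εf + K) < 0.1 at hsmall
  have hbd : ∀ k, k ≤ N → t k * Real.exp (S k) * (εf + K) ≤ T * Real.exp (S N) * (εf + K) := by
    intro k hk
    have h1 := htT k hk
    have h2 := Real.exp_le_exp.mpr (hSN k hk)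
    gcongr
  -- consistency
  have hcons : ∀ k < N, ‖h (t (k+1)) - h (t k) - (t (k+1) - t k) • f (h (t k)) (x (t k))‖
      ≤ K * (t (k+1) - t k) := by
    intro k hk
    have hmem : k + 1 ∈ Finset.Icc 1 N := Finset.mem_Icc.mpr ⟨by omega, by omega⟩
    have hlt := ht_mono k hk
    have hsub : Set.Icc (t k) (t (k+1)) ⊆ Set.Icc 0 T :=
      Set.Icc_subset_Icc (htpos k hk.le) (htT (k+1) hk)
    have hd : ∀ s ∈ Set.Icc (t k) (t (k+1)),
        HasDerivWithinAt h (f (h s) (x s)) (Set.Icc (t k) (t (k+1))) s :=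
      fun s hs => (hh_deriv s (hsub hs)).mono hsub
    have hhB : ∀ s ∈ Set.Icc (t k) (t (k+1)), h s ∈ Bh (k+1) := fun s hs =>
      hBh_nbhd _ hmem _ ⟨s, by simpa using hs, by norm_num⟩
    have hxB : ∀ s ∈ Set.Icc (t k) (t (k+1)), x s ∈ Bx (k+1) := fun s hs =>
      hBx_nbhd _ hmem _ (hx_range s (hsub hs)) ⟨s, by simpa using hs, by norm_num⟩
    have hl : t k ∈ Set.Icc (t k) (t (k+1)) := ⟨le_rfl, hlt.le⟩
    have hr : t (k+1) ∈ Set.Icc (t k) (t (k+1)) := ⟨hlt.le, le_rfl⟩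
    have hhL : ∀ s ∈ Set.Icc (t k) (t (k+1)), ‖h s - h (t k)‖ ≤ Mf (k+1) * (t (k+1) - t k) := by
      intro s hs
      have := (convex_Icc (t k) (t (k+1))).norm_image_sub_le_of_norm_hasDerivWithin_le hd
        (fun s hs => hMf _ hmem _ (hhB s hs) _ (hxB s hs)) hl hs
      refine this.trans (mul_le_mul_of_nonneg_left ?_ (hMf_nonneg _))
      rw [Real.norm_of_nonneg (by linarith [hs.1])]
      linarith [hs.2]
    have hder : ∀ s ∈ Set.Icc (t k) (t (k+1)),
        ‖f (h s) (x s) - f (h (t k)) (x (t k))‖ ≤ K := by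
      intro s hs
      have h1 := hLiph _ hmem _ (hhB s hs) _ (hhB _ hl) _ (hxB s hs)
      have h2 := hLipx _ hmem _ (hhB _ hl) _ (hxB s hs) _ (hxB _ hl)
      have h3 := hxLip _ hmem s (by simpa using hs) (t k) (by simpa using hlt.le)
      have h4 : |s - t k| ≤ t (k+1) - t k := by
        rw [abs_of_nonneg (by linarith [hs.1])]; linarith [hs.2]
      have h5 := mul_le_mul_of_nonneg_left (hhL s hs) (hLfh_nonneg (k+1))
      have h6 := mul_le_mul_of_nonneg_left
        (h3.trans (mul_le_mul_of_nonneg_left h4 (hLx_nonneg (k+1)))) (hLfx_nonneg (k+1))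
      have h7 := norm_sub_le_norm_sub_add_norm_sub (f (h s) (x s)) (f (h (t k)) (x s))
        (f (h (t k)) (x (t k)))
      have := hKle k hk
      nlinarith
    have hd2 : ∀ s ∈ Set.Icc (t k) (t (k+1)),
        HasDerivWithinAt (fun s => h s - s • f (h (t k)) (x (t k)))
          (f (h s) (x s) - f (h (t k)) (x (t k))) (Set.Icc (t k) (t (k+1))) s := by
      intro s hs
      have := (hd s hs).sub ((hasDerivWithinAt_id s (Set.Icc (t k) (t (k+1)))).smul_const
        (f (h (t k)) (x (t k))))
      rw [one_smul] at this
      exact this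
    have := (convex_Icc (t k) (t (k+1))).norm_image_sub_le_of_norm_hasDerivWithin_le hd2
      hder hl hr
    rw [Real.norm_of_nonneg (by linarith)] at this
    refine le_trans (le_of_eq ?_) this
    congr 1
    rw [sub_smul]; abel
  have herr : ∀ k, k ≤ N → ‖h (t k) - hhat k‖ ≤ t k * Real.exp (S k) * (εf + K) := by
    intro k
    induction k with
    | zero => intro _; simp [ht0, hhat0]
    | succ k ih =>
      intro hk
      have hk' : k < N := hk
      have ih := ih hk'.le
      have hmem : k + 1 ∈ Finset.Icc 1 N := Finset.mem_Icc.mpr ⟨by omega, by omega⟩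
      have hlt := ht_mono k hk'
      have hsm : ‖h (t k) - hhat k‖ ≤ 0.1 := (ih.trans (hbd k hk'.le)).trans hsmall.le
      have htk : t k ∈ Set.Icc 0 T := ⟨htpos k hk'.le, htT k hk'.le⟩
      have hl : t k ∈ Set.Icc (t (k+1-1)) (t (k+1)) := by simpa using hlt.le
      have hB1 : hhat k ∈ Bh (k+1) := hBh_nbhd _ hmem _ ⟨t k, hl, by rwa [norm_sub_rev]⟩
      have hB2 : h (t k) ∈ Bh (k+1) := hBh_nbhd _ hmem _ ⟨t k, hl, by norm_num⟩
      have hB3 : x (t k) ∈ Bx (k+1) :=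
        hBx_nbhd _ hmem _ (hx_range _ htk) ⟨t k, hl, by norm_num⟩
      have e1 := hLiph _ hmem _ hB2 _ hB1 _ hB3
      have e2 := hεf (hhat k) (x (t k)) (hBh_sub _ hmem _ hB1) (hx_range _ htk)
      have e3 := hcons k hk'
      have hrec := hhat_rec (k+1) (by omega) hk
      simp only [Nat.add_sub_cancel] at hrec
      set Δ := t (k+1) - t k with hΔ
      have hΔ0 : 0 ≤ Δ := by linarith
      have hdec : h (t (k+1)) - hhat (k+1) =
          (h (t k) - hhat k) + (h (t (k+1)) - h (t k) - Δ • f (h (t k)) (x (t k)))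
          + Δ • (f (h (t k)) (x (t k)) - f (hhat k) (x (t k)))
          + Δ • (f (hhat k) (x (t k)) - fθ (hhat k) (x (t k))) := by
        rw [hrec]; simp only [smul_sub]; abel
      have hn : ‖h (t (k+1)) - hhat (k+1)‖ ≤ ‖h (t k) - hhat k‖ + K * Δ
          + Δ * (Lfh (k+1) * ‖h (t k) - hhat k‖) + Δ * εf := by
        rw [hdec]
        refine (norm_add_le _ _).trans (add_le_add ((norm_add_le _ _).trans
          (add_le_add ((norm_add_le _ _).trans (add_le_add le_rfl e3)) ?_)) ?_)
        · rw [norm_smul, Real.norm_of_nonneg hΔ0]; gcongr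
        · rw [norm_smul, Real.norm_of_nonneg hΔ0]; gcongr
      have hex : (1 + Lfh (k+1) * Δ) * Real.exp (S k) ≤ Real.exp (S (k+1)) := by
        rw [hSsucc, add_comm (S k), Real.exp_add]
        gcongr
        linarith [Real.add_one_le_exp (Lfh (k+1) * Δ)]
      have hone : 1 ≤ Real.exp (S (k+1)) := Real.one_le_exp (hS0 _ hk)
      have hL0 : 0 ≤ 1 + Lfh (k+1) * Δ := by
        have := mul_nonneg (hLfh_nonneg (k+1)) hΔ0; linarith
      have hc : 0 ≤ εf + K := by linarith
      have q1 : (1 + Lfh (k+1) * Δ) * ‖h (t k) - hhat k‖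
          ≤ t k * Real.exp (S (k+1)) * (εf + K) := by
        calc _ ≤ (1 + Lfh (k+1) * Δ) * (t k * Real.exp (S k) * (εf + K)) := by gcongr
          _ = t k * ((1 + Lfh (k+1) * Δ) * Real.exp (S k)) * (εf + K) := by ring
          _ ≤ _ := by
            have := htk.1
            gcongr
      have q2 : Δ * 1 * (εf + K) ≤ Δ * Real.exp (S (k+1)) * (εf + K) := by gcongr
      have : t (k+1) = t k + Δ := by rw [hΔ]; ring
      rw [this]
      rw [this] at hn
      linarith
  intro i hi1 hiN
  have hmem : i ∈ Finset.Icc 1 N := Finset.mem_Icc.mpr ⟨hi1, hiN⟩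
  obtain ⟨k, rfl⟩ : ∃ k, i = k + 1 := ⟨i - 1, by omega⟩
  have hl : t (k+1) ∈ Set.Icc (t (k+1-1)) (t (k+1)) := by simpa using (ht_mono k hiN).le
  have hE := (herr (k+1) hiN).trans (hbd _ hiN)
  have r1 := hBh_sub _ hmem _ (hBh_nbhd _ hmem (h (t (k+1))) ⟨_, hl, by norm_num⟩)
  have r2 := hBh_sub _ hmem _ (hBh_nbhd _ hmem (hhat (k+1))
    ⟨_, hl, by rw [norm_sub_rev]; exact hE.trans hsmall.le⟩)
  rw [hyhat _ hi1 hiN]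
  have a1 := hgLip _ _ r1 r2
  have a2 := hεg _ r2
  have a3 := norm_sub_le_norm_sub_add_norm_sub (g (h (t (k+1)))) (g (hhat (k+1))) (gφ (hhat (k+1)))
  have a4 := mul_le_mul_of_nonneg_left hE hLg
  change _ ≤ εg + Lg * T * Real.exp (S N) * (εf + K)
  linarith
end
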